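/- Let u = (u_1,…,u_N) : ℝ^d × [0,T) → ℝ^N be a classical solution of the Allen–Cahn system (AC) with Σ_{i=1}^N u_i(x,t)² = 1 for all (x,t), and suppose μ₀ᵋ(Q) ≤ D. Let φ : ℝ^d → [0,∞) be a ℤ^d-periodic C² function and C > 0 a constant such that |∇φ(x)|² ≤ C φ(x) for all x with φ(x) > 0 and ∇φ(x) = 0 whenever φ(x) = 0. Then for every t ∈ (0,T), ∫_Q ( ε φ |∂_t u(x,t)|² + Σ_{i=1}^N ε (∇φ(x) · ∇u_i(x,t)) ∂_t u_i(x,t) ) dx ≥ − (C σ D)/2. -/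

import Mathlib

open MeasureTheory Set Filter
open scoped InnerProductSpace

noncomputable section

/-- Euclidean space `ℝ^d`. -/
abbrev Euc (d : ℕ) := EuclideanSpace ℝ (Fin d)

/-- The double-well potential `W(s) = s²(1-s)²/2`. -/
def W (s : ℝ) : ℝ := s ^ 2 * (1 - s) ^ 2 / 2

/-- Its derivative `W'(s) = 2s³ - 3s² + s`. -/
def W' (s : ℝ) : ℝ := 2 * s ^ 3 - 3 * s ^ 2 + s

/-- Partial derivative in the `k`-th coordinate direction. -/
def pd (d : ℕ) (k : Fin d) (f : Euc d → ℝ) (x : Euc d) : ℝ :=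
  fderiv ℝ f x (EuclideanSpace.single k 1)

/-- The Laplacian of `f : ℝ^d → ℝ`. -/
def lap (d : ℕ) (f : Euc d → ℝ) (x : Euc d) : ℝ :=
  ∑ k : Fin d, pd d k (fun y => pd d k f y) x

/-- The vector in `ℝ^d` with integer coordinates `v`. -/
def intVec {d : ℕ} (v : Fin d → ℤ) : Euc d :=
  (EuclideanSpace.equiv (Fin d) ℝ).symm (fun k => (v k : ℝ))

/-- A function on `ℝ^d` is `ℤ^d`-periodic if it is invariant under translation by
every integer vector. -/
def ZPeriodic {d : ℕ} {α : Type*} (f : Euc d → α) : Prop :=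
  ∀ (x : Euc d) (v : Fin d → ℤ), f (x + intVec v) = f x

/-- The fundamental domain `Q = [0,1)^d` of the torus. -/
def QCube (d : ℕ) : Set (Euc d) := {x | ∀ k, x k ∈ Ico (0:ℝ) 1}

/-- `σ = ∫₀¹ √(2W(a)) da`. -/
def sigma0 : ℝ := ∫ a in (0:ℝ)..1, Real.sqrt (2 * W a)

/-- A classical solution of the Allen–Cahn system (AC): `ℤ^d`-periodic in `x`, twice
continuously differentiable in `x` and once in `t` (with continuous derivatives), and
satisfying `ε ∂ₜ uᵢ = ε Δuᵢ - W'(uᵢ)/ε + λᵋ uᵢ` on `ℝ^d × (0,T)`, where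
`λᵋ = Σⱼ uⱼ (-ε Δuⱼ + W'(uⱼ)/ε)`. -/
structure IsACSolution (d N : ℕ) (T ε : ℝ) (u : Fin N → ℝ → Euc d → ℝ) : Prop where
  periodic : ∀ i t, ZPeriodic (u i t)
  regx : ∀ i t, ContDiff ℝ 2 (u i t)
  regt : ∀ i x, ContDiffOn ℝ 1 (fun s => u i s x) (Ico 0 T)
  cont_u : ∀ i, ContinuousOn (fun p : ℝ × Euc d => u i p.1 p.2) (Ico 0 T ×ˢ univ)
  cont_dt : ∀ i, ContinuousOn (fun p : ℝ × Euc d => deriv (fun s => u i s p.2) p.1)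
    (Ioo 0 T ×ˢ univ)
  cont_grad : ∀ i, ContinuousOn (fun p : ℝ × Euc d => gradient (u i p.1) p.2)
    (Ico 0 T ×ˢ univ)
  cont_lap : ∀ i, ContinuousOn (fun p : ℝ × Euc d => lap d (u i p.1) p.2)
    (Ico 0 T ×ˢ univ)
  eqn : ∀ i x, ∀ t ∈ Ioo 0 T,
    ε * deriv (fun s => u i s x) t =
      ε * lap d (u i t) x - W' (u i t x) / ε +
        (∑ j, u j t x * (-(ε * lap d (u j t) x) + W' (u j t x) / ε)) * u i t x

/-- `μₜ^{i,ε}(Q) = σ⁻¹ ∫_Q (ε|∇uᵢ|²/2 + W(uᵢ)/ε) dx`. -/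
def muI (d : ℕ) (ε : ℝ) (f : ℝ → Euc d → ℝ) (t : ℝ) : ℝ :=
  sigma0⁻¹ * ∫ x in QCube d, (ε * ‖gradient (f t) x‖ ^ 2 / 2 + W (f t x) / ε)

/-- `μₜᵋ(Q) = Σᵢ μₜ^{i,ε}(Q)`. -/
def muE (d N : ℕ) (ε : ℝ) (u : Fin N → ℝ → Euc d → ℝ) (t : ℝ) : ℝ :=
  ∑ i, muI d ε (u i) t

lemma measurableSet_QCube (d : ℕ) : MeasurableSet (QCube d) := by
  have : QCube d = ⋂ k, (fun x : Euc d => x k) ⁻¹' Ico (0:ℝ) 1 := by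
    ext x; simp [QCube]
  rw [this]
  exact MeasurableSet.iInter fun k =>
    measurableSet_Ico.preimage (EuclideanSpace.proj (𝕜 := ℝ) k).continuous.measurable

lemma isCompact_closedCube (d : ℕ) : IsCompact {x : Euc d | ∀ k, x k ∈ Icc (0:ℝ) 1} := by
  have h := (isCompact_univ_pi fun _ : Fin d => isCompact_Icc (a := (0:ℝ)) (b := 1)).image
    (EuclideanSpace.equiv (Fin d) ℝ).symm.continuous
  convert h using 1
  ext x
  constructor
  · intro hx
    exact ⟨EuclideanSpace.equiv (Fin d) ℝ x, fun k _ => hx k, by simp⟩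
  · rintro ⟨y, hy, rfl⟩ k
    exact hy k (mem_univ k)

lemma QCube_subset_closedCube (d : ℕ) : QCube d ⊆ {x : Euc d | ∀ k, x k ∈ Icc (0:ℝ) 1} :=
  fun _ hx k => Ico_subset_Icc_self (hx k)

lemma volume_QCube_lt_top (d : ℕ) : volume (QCube d) < ⊤ :=
  (measure_mono (QCube_subset_closedCube d)).trans_lt (isCompact_closedCube d).measure_lt_top

lemma Continuous.integrableOn_QCube {d : ℕ} {F : Euc d → ℝ} (hF : Continuous F) :
    IntegrableOn F (QCube d) :=
  (hF.continuousOn.integrableOn_compact (isCompact_closedCube d)).mono_set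
    (QCube_subset_closedCube d)

lemma setIntegral_QCube_eq (d : ℕ) (F : Euc d → ℝ) :
    ∫ x in QCube d, F x = ∫ y in Icc (0 : Fin d → ℝ) 1, F (WithLp.toLp 2 y) := by
  rw [← (PiLp.volume_preserving_toLp (Fin d)).setIntegral_preimage_emb
    (MeasurableEquiv.toLp 2 (Fin d → ℝ)).measurableEmbedding]
  apply setIntegral_congr_set
  have : WithLp.toLp 2 ⁻¹' QCube d = univ.pi fun _ : Fin d => Ico (0:ℝ) 1 := by
    ext y; simp [QCube]
  rw [this]
  exact Measure.univ_pi_Ico_ae_eq_Icc (f := (0 : Fin d → ℝ)) (g := 1)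

lemma pd_continuous {d : ℕ} {F : Euc d → ℝ} (hF : ContDiff ℝ 1 F) (k : Fin d) :
    Continuous (pd d k F) :=
  (hF.continuous_fderiv one_ne_zero).clm_apply continuous_const

/-- The integral of a partial derivative of a periodic function over the torus vanishes. -/
lemma setIntegral_pd_eq_zero {d : ℕ} {F : Euc d → ℝ} (hF : ContDiff ℝ 1 F)
    (hp : ZPeriodic F) (k : Fin d) : ∫ x in QCube d, pd d k F x = 0 := by
  rw [setIntegral_QCube_eq]
  obtain _ | n := d
  · exact k.elim0
  set L : (Fin (n + 1) → ℝ) →L[ℝ] Euc (n + 1) :=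
    ((EuclideanSpace.equiv (Fin (n + 1)) ℝ).symm : (Fin (n + 1) → ℝ) →L[ℝ] Euc (n + 1)) with hL
  have hLy : ∀ y, WithLp.toLp 2 y = L y := fun y => rfl
  have hder : ∀ y, HasFDerivAt (fun y => F (L y)) ((fderiv ℝ F (L y)).comp L) y := fun y =>
    ((hF.differentiable one_ne_zero) (L y)).hasFDerivAt.comp y L.hasFDerivAt
  have hpd : ∀ y, (∑ i, (if i = k then (fderiv ℝ F (L y)).comp L else 0 :
      (Fin (n + 1) → ℝ) →L[ℝ] ℝ) (Pi.single i 1)) = pd (n + 1) k F (L y) := by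
    intro y
    rw [Finset.sum_eq_single k]
    · simp only [if_true, ContinuousLinearMap.comp_apply, pd]
      rfl
    · intro b _ hb; simp [hb]
    · simp
  have key := integral_divergence_of_hasFDerivAt_off_countable' (0 : Fin (n + 1) → ℝ) 1
    zero_le_one (fun i y => if i = k then F (L y) else 0)
    (fun i y => if i = k then (fderiv ℝ F (L y)).comp L else 0) ∅ countable_empty
    (fun i => by
      by_cases h : i = k
      · simp only [h, if_true]
        exact (hF.continuous.comp L.continuous).continuousOn
      · simpa [h] using continuousOn_const)
    (fun y _ i => by
      by_cases h : i = k
      · simpa [h] using hder y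
      · simpa [h] using hasFDerivAt_const (0:ℝ) y)
    (by
      simp only [hpd]
      exact (((pd_continuous hF k).comp L.continuous).continuousOn).integrableOn_compact
        isCompact_Icc)
  simp only [hpd] at key
  simp only [hLy]
  rw [key]
  refine Finset.sum_eq_zero fun i _ => ?_
  by_cases h : i = k
  · subst h
    simp only [if_true, sub_eq_zero]
    refine integral_congr_ae (Eventually.of_forall fun z => ?_)
    have h1 : L (i.insertNth ((1 : Fin (n + 1) → ℝ) i) z)
        = L (i.insertNth ((0 : Fin (n + 1) → ℝ) i) z) + intVec (Pi.single i 1) := by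
      ext j
      refine Fin.succAboveCases i ?_ (fun j => ?_) j
      · simp [hL, intVec]
      · simp [hL, intVec]
    simp only [h1, hp _ _]
  · simp [h]

lemma inner_gradient_eq_sum_pd {d : ℕ} (f g : Euc d → ℝ) (x : Euc d) :
    ⟪gradient f x, gradient g x⟫_ℝ = ∑ k, pd d k f x * pd d k g x := by
  have h : ∀ (f : Euc d → ℝ) k, gradient f x k = pd d k f x := by
    intro f k
    have := EuclideanSpace.inner_single_right k (1:ℝ) (gradient f x)
    rw [inner_gradient_left] at this
    simpa [pd] using this.symm
  rw [PiLp.inner_apply]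
  simp [h, mul_comm]

lemma pd_contDiff {d : ℕ} {f : Euc d → ℝ} (hf : ContDiff ℝ 2 f) (k : Fin d) :
    ContDiff ℝ 1 (pd d k f) :=
  (hf.fderiv_right (m := 1) (by norm_num)).clm_apply contDiff_const

lemma pd_periodic {d : ℕ} {f : Euc d → ℝ} (hf : ZPeriodic f) (k : Fin d) :
    ZPeriodic (pd d k f) := by
  intro x v
  have : (fun y => f (y + intVec v)) = f := funext fun y => hf y v
  rw [pd, ← fderiv_comp_add_right, this, pd]

/-- Green's identity on the torus. -/
lemma setIntegral_inner_gradient {d : ℕ} {f g : Euc d → ℝ} (hf : ContDiff ℝ 2 f)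
    (hg : ContDiff ℝ 1 g) (hfp : ZPeriodic f) (hgp : ZPeriodic g) :
    ∫ x in QCube d, ⟪gradient f x, gradient g x⟫_ℝ = - ∫ x in QCube d, lap d f x * g x := by
  have hd : ∀ k x, pd d k (fun y => pd d k f y * g y) x
      = pd d k f x * pd d k g x + pd d k (fun y => pd d k f y) x * g x := by
    intro k x
    have h1 := (pd_contDiff hf k).differentiable one_ne_zero x
    have h2 := hg.differentiable one_ne_zero x
    change fderiv ℝ (fun y => pd d k f y * g y) x _ = pd d k f x * fderiv ℝ g x _ +
      fderiv ℝ (pd d k f) x _ * g x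
    rw [fderiv_fun_mul h1 h2]
    simp [mul_comm]
  have h0 : ∀ k, ∫ x in QCube d, pd d k (fun y => pd d k f y * g y) x = 0 := fun k =>
    setIntegral_pd_eq_zero ((pd_contDiff hf k).mul hg)
      (fun x v => by simp only [pd_periodic hfp k x v, hgp x v]) k
  have hc1 : ∀ k, Continuous (fun x => pd d k f x * pd d k g x) := fun k =>
    (pd_contDiff hf k).continuous.mul (pd_continuous hg k)
  have hc2 : ∀ k, Continuous (fun x => pd d k (fun y => pd d k f y) x * g x) := fun k =>
    (pd_continuous (pd_contDiff hf k) k).mul hg.continuous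
  rw [eq_neg_iff_add_eq_zero]
  simp only [inner_gradient_eq_sum_pd, lap, Finset.sum_mul]
  rw [integral_finsetSum _ fun k _ => (hc1 k).integrableOn_QCube,
    integral_finsetSum _ fun k _ => (hc2 k).integrableOn_QCube, ← Finset.sum_add_distrib]
  refine Finset.sum_eq_zero fun k _ => ?_
  rw [← integral_add (hc1 k).integrableOn_QCube (hc2 k).integrableOn_QCube, ← h0 k]
  simp only [hd]

lemma exists_abs_le_on_QCube {d : ℕ} {S K : Set ℝ} {H : ℝ × Euc d → ℝ}
    (hH : ContinuousOn H (S ×ˢ univ)) (hK : IsCompact K) (hKS : K ⊆ S) :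
    ∃ M, ∀ s ∈ K, ∀ x ∈ QCube d, |H (s, x)| ≤ M := by
  obtain ⟨M, hM⟩ := (hK.prod (isCompact_closedCube d)).exists_bound_of_continuousOn
    (hH.mono (prod_mono hKS (subset_univ _)))
  exact ⟨M, fun s hs x hx => hM (s, x) ⟨hs, QCube_subset_closedCube d hx⟩⟩

lemma ContinuousOn.continuous_slice {d : ℕ} {α : Type*} [TopologicalSpace α] {S : Set ℝ}
    {H : ℝ × Euc d → α} (hH : ContinuousOn H (S ×ˢ univ)) {s : ℝ} (hs : s ∈ S) :
    Continuous fun x => H (s, x) :=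
  hH.comp_continuous (by fun_prop) fun _ => ⟨hs, mem_univ _⟩

lemma continuousOn_setIntegral_QCube {d : ℕ} {S : Set ℝ} [LocallyCompactSpace S]
    {H : ℝ × Euc d → ℝ} (hH : ContinuousOn H (S ×ˢ univ)) :
    ContinuousOn (fun t => ∫ x in QCube d, H (t, x)) S := by
  rw [continuousOn_iff_continuous_domRestrict]
  have h : Continuous (Function.uncurry fun (t : S) (x : Euc d) => H (t, x)) :=
    hH.comp_continuous (by fun_prop) fun p => ⟨p.1.2, mem_univ _⟩
  have := continuous_parametric_integral_of_continuous (μ := volume.restrict (QCube d)) h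
    (isCompact_closedCube d)
  rwa [Measure.restrict_restrict (isCompact_closedCube d).measurableSet,
    inter_eq_right.2 (QCube_subset_closedCube d)] at this

lemma lap_continuous {d : ℕ} {f : Euc d → ℝ} (hf : ContDiff ℝ 2 f) : Continuous (lap d f) :=
  continuous_finsetSum _ fun k _ => pd_continuous (pd_contDiff hf k) k

lemma gradient_continuous {d : ℕ} {f : Euc d → ℝ} (hf : ContDiff ℝ 1 f) :
    Continuous (gradient f) :=
  (InnerProductSpace.toDual ℝ (Euc d)).symm.continuous.comp
    (hf.continuous_fderiv one_ne_zero)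

lemma W_continuous : Continuous W := by unfold W; fun_prop

lemma W'_continuous : Continuous W' := by unfold W'; fun_prop

/-- The symmetric divided difference of `W`. -/
def dividedW (a b : ℝ) : ℝ := (1 - a - b) * (a - a ^ 2 + b - b ^ 2) / 2

lemma dividedW_mul_sub (a b : ℝ) : dividedW a b * (a - b) = W a - W b := by
  unfold dividedW W; ring

lemma dividedW_self (a : ℝ) : dividedW a a = W' a := by
  unfold dividedW W'; ring

lemma dividedW_continuous : Continuous (Function.uncurry dividedW) := by
  unfold dividedW Function.uncurry; fun_prop

/-- The difference of two Allen–Cahn energies, written without gradients. -/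
lemma energy_sub_eq {d : ℕ} {f g : Euc d → ℝ} (ε : ℝ) (hf : ContDiff ℝ 2 f)
    (hg : ContDiff ℝ 2 g) (hfp : ZPeriodic f) (hgp : ZPeriodic g) :
    (∫ x in QCube d, (ε * ‖gradient f x‖ ^ 2 / 2 + W (f x) / ε))
      - ∫ x in QCube d, (ε * ‖gradient g x‖ ^ 2 / 2 + W (g x) / ε)
    = ∫ x in QCube d, (-(ε / 2) * (lap d f x + lap d g x) + dividedW (f x) (g x) / ε)
        * (f x - g x) := by
  have hlf := lap_continuous hf
  have hlg := lap_continuous hg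
  have hf1 := hf.of_le (m := 1) (by norm_num)
  have hg1 := hg.of_le (m := 1) (by norm_num)
  have cf := hf.continuous
  have cg := hg.continuous
  have cgf := gradient_continuous hf1
  have cgg := gradient_continuous hg1
  have cW := W_continuous
  have ff := setIntegral_inner_gradient hf hf1 hfp hfp
  have gg := setIntegral_inner_gradient hg hg1 hgp hgp
  have fg := setIntegral_inner_gradient hf hg1 hfp hgp
  have gf := setIntegral_inner_gradient hg hf1 hgp hfp
  simp only [real_inner_self_eq_norm_sq] at ff gg
  simp only [real_inner_comm] at fg gf
  have e1 : ∀ h : Euc d → ℝ, Continuous h → Continuous (gradient h) →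
      ∫ x in QCube d, (ε * ‖gradient h x‖ ^ 2 / 2 + W (h x) / ε)
        = ε / 2 * (∫ x in QCube d, ‖gradient h x‖ ^ 2) + ∫ x in QCube d, W (h x) / ε := by
    intro h ch cgh
    rw [integral_add (Continuous.integrableOn_QCube (by fun_prop))
      (Continuous.integrableOn_QCube (by fun_prop)), ← integral_const_mul]
    congr 2
    ext x; ring
  have e2 : ∀ x, (-(ε / 2) * (lap d f x + lap d g x) + dividedW (f x) (g x) / ε)
        * (f x - g x) = -(ε / 2) * (lap d f x * f x - lap d f x * g x + lap d g x * f x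
          - lap d g x * g x) + (W (f x) / ε - W (g x) / ε) := by
    intro x
    rw [← sub_div, ← dividedW_mul_sub]; ring
  have i1 : IntegrableOn (fun x => lap d f x * f x) (QCube d) :=
    Continuous.integrableOn_QCube (by fun_prop)
  have i2 : IntegrableOn (fun x => lap d f x * g x) (QCube d) :=
    Continuous.integrableOn_QCube (by fun_prop)
  have i3 : IntegrableOn (fun x => lap d g x * f x) (QCube d) :=
    Continuous.integrableOn_QCube (by fun_prop)
  have i4 : IntegrableOn (fun x => lap d g x * g x) (QCube d) :=
    Continuous.integrableOn_QCube (by fun_prop)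
  have i5 : IntegrableOn (fun x => W (f x) / ε) (QCube d) :=
    Continuous.integrableOn_QCube (by fun_prop)
  have i6 : IntegrableOn (fun x => W (g x) / ε) (QCube d) :=
    Continuous.integrableOn_QCube (by fun_prop)
  rw [e1 f cf cgf, e1 g cg cgg]
  simp only [e2]
  have j1 : IntegrableOn (fun x => lap d f x * f x - lap d f x * g x) (QCube d) := i1.sub i2
  have j2 : IntegrableOn (fun x => lap d f x * f x - lap d f x * g x + lap d g x * f x)
    (QCube d) := j1.add i3
  have j3 : IntegrableOn (fun x => -(ε / 2) * (lap d f x * f x - lap d f x * g x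
    + lap d g x * f x - lap d g x * g x)) (QCube d) := (j2.sub i4).const_mul _
  have j4 : IntegrableOn (fun x => W (f x) / ε - W (g x) / ε) (QCube d) := i5.sub i6
  rw [integral_add j3 j4, integral_const_mul,
    integral_sub j2 i4, integral_add j1 i3, integral_sub i1 i2, integral_sub i5 i6, ff, gg]
  have : ∫ x in QCube d, lap d f x * g x = ∫ x in QCube d, lap d g x * f x := by linarith
  rw [this]; ring

open scoped Topology in
/-- The first variation of the Allen–Cahn energy along a periodic curve of functions. -/
lemma hasDerivAt_energy {d : ℕ} {v : ℝ → Euc d → ℝ} {a b t ε : ℝ} (ht : t ∈ Ioo a b)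
    (hp : ∀ s, ZPeriodic (v s)) (hx : ∀ s, ContDiff ℝ 2 (v s))
    (hd : ∀ x, ∀ s ∈ Ioo a b, DifferentiableAt ℝ (fun s => v s x) s)
    (hv : ContinuousOn (fun p : ℝ × Euc d => v p.1 p.2) (Ioo a b ×ˢ univ))
    (hdv : ContinuousOn (fun p : ℝ × Euc d => deriv (fun s => v s p.2) p.1)
      (Ioo a b ×ˢ univ))
    (hl : ContinuousOn (fun p : ℝ × Euc d => lap d (v p.1) p.2) (Ioo a b ×ˢ univ)) :
    HasDerivAt (fun s => ∫ x in QCube d, (ε * ‖gradient (v s) x‖ ^ 2 / 2 + W (v s x) / ε))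
      (∫ x in QCube d, (-(ε * lap d (v t) x) + W' (v t x) / ε) * deriv (fun s => v s x) t)
      t := by
  rw [hasDerivAt_iff_tendsto_slope]
  set F : ℝ → Euc d → ℝ := fun s x =>
    (-(ε / 2) * (lap d (v s) x + lap d (v t) x) + dividedW (v s x) (v t x) / ε) with hF
  have hslope : ∀ s, slope (fun s => ∫ x in QCube d,
      (ε * ‖gradient (v s) x‖ ^ 2 / 2 + W (v s x) / ε)) t s
      = ∫ x in QCube d, F s x * slope (fun s => v s x) t s := by
    intro s
    rw [slope_def_field, energy_sub_eq ε (hx s) (hx t) (hp s) (hp t), ← integral_div]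
    simp only [hF, slope_def_field, mul_div_assoc]
  simp only [funext hslope]
  have hFcont : ContinuousOn (fun p : ℝ × Euc d => F p.1 p.2) (Ioo a b ×ˢ univ) := by
    have h1 : Continuous fun p : ℝ × Euc d => lap d (v t) p.2 :=
      (lap_continuous (hx t)).comp continuous_snd
    have h2 : Continuous fun p : ℝ × Euc d => v t p.2 := (hx t).continuous.comp continuous_snd
    have h3 : ContinuousOn (fun p : ℝ × Euc d => dividedW (v p.1 p.2) (v t p.2))
        (Ioo a b ×ˢ univ) := dividedW_continuous.comp_continuousOn (hv.prodMk h2.continuousOn)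
    exact (continuousOn_const.mul (hl.add h1.continuousOn)).add (h3.div_const _)
  obtain ⟨δ, hδ, hsub⟩ := Metric.nhds_basis_closedBall.mem_iff.1 (Ioo_mem_nhds ht.1 ht.2)
  have htδ : t ∈ Metric.closedBall t δ := Metric.mem_closedBall_self hδ.le
  have hnear : ∀ᶠ s in 𝓝[≠] t, s ∈ Metric.closedBall t δ :=
    mem_nhdsWithin_of_mem_nhds (Metric.closedBall_mem_nhds t hδ)
  obtain ⟨M₁, hM₁⟩ := exists_abs_le_on_QCube hFcont (isCompact_closedBall t δ) hsub
  obtain ⟨M₂, hM₂⟩ := exists_abs_le_on_QCube hdv (isCompact_closedBall t δ) hsub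
  refine tendsto_integral_filter_of_dominated_convergence (fun _ => M₁ * M₂) ?_ ?_ ?_ ?_
  · filter_upwards [hnear] with s hs
    have h1 : Continuous (F s) := hFcont.continuous_slice (hsub hs)
    have h2 : Continuous fun x => slope (fun s => v s x) t s := by
      simp only [slope_def_field]
      exact ((hx s).continuous.sub (hx t).continuous).div_const _
    exact (h1.mul h2).aestronglyMeasurable
  · filter_upwards [hnear] with s hs
    filter_upwards [ae_restrict_mem (measurableSet_QCube d)] with x hxQ
    have h1 := hM₁ s hs x hxQ
    have h2 := (convex_closedBall t δ).norm_image_sub_le_of_norm_deriv_le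
      (fun r hr => hd x r (hsub hr)) (fun r hr => hM₂ r hr x hxQ) htδ hs
    have h3 : ‖slope (fun s => v s x) t s‖ ≤ M₂ := by
      rw [slope_def_field, norm_div]
      exact div_le_of_le_mul₀ (norm_nonneg _)
        ((abs_nonneg _).trans (hM₂ t htδ x hxQ)) h2
    rw [norm_mul]
    exact mul_le_mul h1 h3 (norm_nonneg _) ((abs_nonneg _).trans h1)
  · exact integrableOn_const (volume_QCube_lt_top d).ne
  · refine Eventually.of_forall fun x => ?_
    have h1 : Tendsto (fun s => F s x) (𝓝[≠] t) (𝓝 (F t x)) := by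
      have hc : ContinuousAt (fun p : ℝ × Euc d => F p.1 p.2) (t, x) :=
        hFcont.continuousAt (prod_mem_nhds (Ioo_mem_nhds ht.1 ht.2) univ_mem)
      exact (ContinuousAt.comp (f := fun s : ℝ => (s, x)) hc
        (by fun_prop)).tendsto.mono_left nhdsWithin_le_nhds
    have h2 := hasDerivAt_iff_tendsto_slope.1 (hd x t ht).hasDerivAt
    convert h1.mul h2 using 3
    simp only [hF, dividedW_self]
    ring

lemma W_nonneg (s : ℝ) : 0 ≤ W s := by unfold W; positivity

lemma sigma0_pos : 0 < sigma0 := by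
  refine intervalIntegral.intervalIntegral_pos_of_pos_on ?_ (fun x hx => ?_) zero_lt_one
  · exact (Real.continuous_sqrt.comp (continuous_const.mul W_continuous)).intervalIntegrable _ _
  · have h1 : 0 < x := hx.1
    have h2 : 0 < 1 - x := sub_pos.2 hx.2
    unfold W
    positivity

namespace IsACSolution

variable {d N : ℕ} {T ε : ℝ} {u : Fin N → ℝ → Euc d → ℝ}

lemma differentiableAt_time (hu : IsACSolution d N T ε u) (i : Fin N) (x : Euc d) {t : ℝ}
    (ht : t ∈ Ioo 0 T) : DifferentiableAt ℝ (fun s => u i s x) t :=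
  ((hu.regt i x).differentiableOn one_ne_zero).differentiableAt (Ico_mem_nhds ht.1 ht.2)

lemma sum_mul_deriv_eq_zero (hu : IsACSolution d N T ε u)
    (hsph : ∀ x, ∀ t ∈ Ico 0 T, ∑ i, (u i t x) ^ 2 = 1) {t : ℝ} (ht : t ∈ Ioo 0 T)
    (x : Euc d) : ∑ i, u i t x * deriv (fun s => u i s x) t = 0 := by
  have h1 : HasDerivAt (fun s => ∑ i, (u i s x) ^ 2)
      (∑ i, 2 * (u i t x * deriv (fun s => u i s x) t)) t := by
    refine HasDerivAt.fun_sum fun i _ => ?_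
    exact ((hu.differentiableAt_time i x ht).hasDerivAt.fun_pow 2).congr_deriv
      (by norm_num [mul_assoc])
  have h2 : HasDerivAt (fun s => ∑ i, (u i s x) ^ 2) 0 t := by
    refine (hasDerivAt_const t (1 : ℝ)).congr_of_eventuallyEq ?_
    filter_upwards [Ico_mem_nhds ht.1 ht.2] with s hs using hsph x s hs
  have := h1.unique h2
  rw [← Finset.mul_sum] at this
  linarith

lemma sum_firstVariation_mul_deriv (hu : IsACSolution d N T ε u)
    (hsph : ∀ x, ∀ t ∈ Ico 0 T, ∑ i, (u i t x) ^ 2 = 1) {t : ℝ} (ht : t ∈ Ioo 0 T)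
    (x : Euc d) :
    ∑ i, (-(ε * lap d (u i t) x) + W' (u i t x) / ε) * deriv (fun s => u i s x) t
      = -(ε * ∑ i, (deriv (fun s => u i s x) t) ^ 2) := by
  set lam := ∑ j, u j t x * (-(ε * lap d (u j t) x) + W' (u j t x) / ε) with hlam
  have h : ∀ i, (-(ε * lap d (u i t) x) + W' (u i t x) / ε) * deriv (fun s => u i s x) t
      = lam * (u i t x * deriv (fun s => u i s x) t)
        - ε * (deriv (fun s => u i s x) t) ^ 2 := by
    intro i
    have := hu.eqn i x t ht
    rw [← hlam] at this
    linear_combination (deriv (fun s => u i s x) t) * this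
  simp only [h]
  rw [Finset.sum_sub_distrib, ← Finset.mul_sum, ← Finset.mul_sum,
    hu.sum_mul_deriv_eq_zero hsph ht x]
  ring

/-- The Allen–Cahn energy is nonincreasing along classical solutions on the sphere. -/
lemma antitoneOn_energy (hu : IsACSolution d N T ε u) (hε : 0 < ε)
    (hsph : ∀ x, ∀ t ∈ Ico 0 T, ∑ i, (u i t x) ^ 2 = 1) :
    AntitoneOn (fun t => ∑ i, ∫ x in QCube d,
      (ε * ‖gradient (u i t) x‖ ^ 2 / 2 + W (u i t x) / ε)) (Ico 0 T) := by
  have hsub : Ioo 0 T ×ˢ (univ : Set (Euc d)) ⊆ Ico 0 T ×ˢ univ :=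
    prod_mono Ioo_subset_Ico_self subset_rfl
  have hder : ∀ t ∈ Ioo 0 T, HasDerivAt (fun t => ∑ i, ∫ x in QCube d,
      (ε * ‖gradient (u i t) x‖ ^ 2 / 2 + W (u i t x) / ε))
      (∑ i, ∫ x in QCube d, (-(ε * lap d (u i t) x) + W' (u i t x) / ε)
        * deriv (fun s => u i s x) t) t := fun t ht =>
    HasDerivAt.fun_sum fun i _ => hasDerivAt_energy ht (hu.periodic i) (hu.regx i)
      (fun x s hs => hu.differentiableAt_time i x hs) ((hu.cont_u i).mono hsub) (hu.cont_dt i)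
      ((hu.cont_lap i).mono hsub)
  have : LocallyCompactSpace (Ico (0:ℝ) T) := by
    refine IsLocallyClosed.locallyCompactSpace ?_
    exact isClosed_Ici.isLocallyClosed.inter isOpen_Iio.isLocallyClosed
  refine antitoneOn_of_deriv_nonpos (convex_Ico 0 T) ?_ ?_ ?_
  · refine continuousOn_finsetSum _ fun i _ => ?_
    refine continuousOn_setIntegral_QCube
      (H := fun p => ε * ‖gradient (u i p.1) p.2‖ ^ 2 / 2 + W (u i p.1 p.2) / ε) ?_
    exact ((continuousOn_const.mul ((hu.cont_grad i).norm.pow 2)).div_const _).add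
      ((W_continuous.comp_continuousOn (hu.cont_u i)).div_const _)
  · rw [interior_Ico]
    exact fun t ht => (hder t ht).differentiableAt.differentiableWithinAt
  · rw [interior_Ico]
    intro t ht
    rw [(hder t ht).deriv, ← integral_finsetSum]
    · refine integral_nonpos fun x => ?_
      simp only [hu.sum_firstVariation_mul_deriv hsph ht x, Pi.zero_apply,
        Left.neg_nonpos_iff]
      positivity
    · intro i _
      have h1 := lap_continuous (hu.regx i t)
      have h2 := (hu.regx i t).continuous
      have h3 := (hu.cont_dt i).continuous_slice ht
      have h4 := W'_continuous
      exact Continuous.integrableOn_QCube (by fun_prop)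

end IsACSolution

/-- Completing the square in the localized dissipation density. -/
lemma neg_le_mul_sq_add_inner_mul {E : Type*} [NormedAddCommGroup E] [InnerProductSpace ℝ E]
    {C f a : ℝ} (hC : 0 ≤ C) (hf : 0 ≤ f) {p g : E} (hp : 0 < f → ‖p‖ ^ 2 ≤ C * f)
    (hp0 : f = 0 → p = 0) :
    -(C / 4 * ‖g‖ ^ 2) ≤ f * a ^ 2 + ⟪p, g⟫_ℝ * a := by
  rcases hf.eq_or_lt with h | h
  · rw [hp0 h.symm, ← h]
    simp only [inner_zero_left, zero_mul, add_zero, Left.neg_nonpos_iff]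
    positivity
  · have h1 : ⟪p, g⟫_ℝ ^ 2 ≤ C * f * ‖g‖ ^ 2 := by
      calc ⟪p, g⟫_ℝ ^ 2 ≤ (‖p‖ * ‖g‖) ^ 2 :=
            sq_le_sq.2 ((abs_real_inner_le_norm p g).trans (le_abs_self _))
        _ = ‖p‖ ^ 2 * ‖g‖ ^ 2 := mul_pow _ _ _
        _ ≤ C * f * ‖g‖ ^ 2 := by gcongr; exact hp h
    have h2 : 0 ≤ f * (f * a ^ 2 + ⟪p, g⟫_ℝ * a + C / 4 * ‖g‖ ^ 2) := by
      nlinarith [sq_nonneg (f * a + ⟪p, g⟫_ℝ / 2)]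
    have := nonneg_of_mul_nonneg_right h2 h
    linarith

/-- For a classical solution of (AC) with `Σᵢ uᵢ² ≡ 1` and
`μ₀ᵋ(Q) ≤ D`, and a nonnegative `ℤ^d`-periodic C² function `φ` with `|∇φ|² ≤ Cφ`
(where `φ > 0`) and `∇φ = 0` (where `φ = 0`), for every `t ∈ (0,T)`:
`∫_Q (εφ|∂ₜu|² + Σᵢ ε(∇φ·∇uᵢ)∂ₜuᵢ) dx ≥ -(CσD)/2`. -/
theorem localized_dissipation_lower_bound
    {d N : ℕ} (hd : 2 ≤ d) (hN : 2 ≤ N) {T ε : ℝ} (hT : 0 < T) (hε : ε ∈ Ioo (0:ℝ) 1)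
    {D : ℝ} (hD : 0 < D)
    (u : Fin N → ℝ → Euc d → ℝ) (hu : IsACSolution d N T ε u)
    (hsph : ∀ x, ∀ t ∈ Ico 0 T, ∑ i, (u i t x) ^ 2 = 1)
    (hinit : muE d N ε u 0 ≤ D)
    (φ : Euc d → ℝ) (hφ0 : ∀ x, 0 ≤ φ x) (hφp : ZPeriodic φ) (hφreg : ContDiff ℝ 2 φ)
    {C : ℝ} (hC : 0 < C)
    (hgrad : ∀ x, 0 < φ x → ‖gradient φ x‖ ^ 2 ≤ C * φ x)
    (hgrad0 : ∀ x, φ x = 0 → gradient φ x = 0) :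
    ∀ t ∈ Ioo 0 T,
      (∫ x in QCube d,
          (ε * φ x * ∑ i, (deriv (fun s => u i s x) t) ^ 2
            + ∑ i, ε * ⟪gradient φ x, gradient (u i t) x⟫_ℝ * deriv (fun s => u i s x) t))
        ≥ -(C * sigma0 * D) / 2 := by
  intro t ht
  have hε0 : 0 < ε := hε.1
  have hσ := sigma0_pos
  have hφg := gradient_continuous (hφreg.of_le (m := 1) (by norm_num))
  have hφc := hφreg.continuous
  have hg : ∀ i, Continuous (gradient (u i t)) := fun i =>
    gradient_continuous ((hu.regx i t).of_le (by norm_num))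
  have huc : ∀ i, Continuous (u i t) := fun i => (hu.regx i t).continuous
  have hdt : ∀ i, Continuous fun x => deriv (fun s => u i s x) t := fun i =>
    (hu.cont_dt i).continuous_slice ht
  have hW := W_continuous
  have henergy : ∑ i, ∫ x in QCube d, (ε * ‖gradient (u i t) x‖ ^ 2 / 2 + W (u i t x) / ε)
      ≤ sigma0 * D := by
    refine (hu.antitoneOn_energy hε0 hsph ⟨le_rfl, hT⟩ ⟨ht.1.le, ht.2⟩ ht.1.le).trans ?_
    simp only [muE, muI, ← Finset.mul_sum] at hinit
    rwa [inv_mul_le_iff₀ hσ] at hinit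
  have hpt : ∀ x, -(C / 2) * ∑ i, (ε * ‖gradient (u i t) x‖ ^ 2 / 2 + W (u i t x) / ε)
      ≤ ε * φ x * ∑ i, (deriv (fun s => u i s x) t) ^ 2
        + ∑ i, ε * ⟪gradient φ x, gradient (u i t) x⟫_ℝ * deriv (fun s => u i s x) t := by
    intro x
    rw [Finset.mul_sum, Finset.mul_sum, ← Finset.sum_add_distrib]
    refine Finset.sum_le_sum fun i _ => ?_
    have h1 := mul_le_mul_of_nonneg_left (neg_le_mul_sq_add_inner_mul
      (a := deriv (fun s => u i s x) t) (g := gradient (u i t) x) hC.le (hφ0 x) (hgrad x)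
      (hgrad0 x)) hε0.le
    have h2 : 0 ≤ C / 2 * (W (u i t x) / ε) :=
      mul_nonneg (by positivity) (div_nonneg (W_nonneg _) hε0.le)
    linarith
  calc -(C * sigma0 * D) / 2 = -(C / 2) * (sigma0 * D) := by ring
    _ ≤ -(C / 2) * ∑ i, ∫ x in QCube d,
          (ε * ‖gradient (u i t) x‖ ^ 2 / 2 + W (u i t x) / ε) :=
        mul_le_mul_of_nonpos_left henergy (by linarith)
    _ = ∫ x in QCube d, -(C / 2) * ∑ i,
          (ε * ‖gradient (u i t) x‖ ^ 2 / 2 + W (u i t x) / ε) := by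
        rw [integral_const_mul, integral_finsetSum]
        intro i _
        have := hg i
        have := huc i
        exact Continuous.integrableOn_QCube (by fun_prop)
    _ ≤ _ := by
        refine setIntegral_mono (Continuous.integrableOn_QCube ?_)
          (Continuous.integrableOn_QCube ?_) hpt
        · fun_prop
        · fun_prop
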